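/- Let μ ∈ M^e_0(Σ_D) ∪ M^e_α(Σ_D), and let (ρ_n)_{n∈ℕ} be a sequence in M^e(Σ_D) such that for every n, ρ_n(B_α) = 1 and ∫ E_α∘φ_α dρ_n > 1. If the push-forward measures ρ_n∘φ_α^{-1} converge to μ∘φ_α^{-1} in the weak* topology on measures on Σ_α, then ρ_n converges to μ in the weak* topology on M(Σ_D). -/

import Mathlib

open MeasureTheory Topology Filter
open scoped ENNReal NNReal


/-! ### The alphabet of the (M,N) Dyck–Motzkin shift -/

/-- The alphabet `D = D_α ∪ D_0 ∪ D_β` of the `(M,N)` Dyck–Motzkin shift: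
`la k` is the left bracket `α_k`, `u k` is the unit `1_k`, `ra k` is the right bracket `β_k`. -/
inductive DMSym (M N : ℕ) : Type where
  | la : Fin M → DMSym M N
  | u  : Fin N → DMSym M N
  | ra : Fin M → DMSym M N
deriving DecidableEq

namespace DMSym

def equivSum (M N : ℕ) : DMSym M N ≃ (Fin M ⊕ Fin N ⊕ Fin M) where
  toFun s := match s with
    | .la k => Sum.inl k
    | .u k => Sum.inr (Sum.inl k)
    | .ra k => Sum.inr (Sum.inr k)
  invFun s := match s with
    | Sum.inl k => .la k
    | Sum.inr (Sum.inl k) => .u k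
    | Sum.inr (Sum.inr k) => .ra k
  left_inv s := by cases s <;> rfl
  right_inv s := by rcases s with k | k | k <;> rfl

instance (M N : ℕ) : Fintype (DMSym M N) := Fintype.ofEquiv _ (equivSum M N).symm
instance (M N : ℕ) : TopologicalSpace (DMSym M N) := ⊥
instance (M N : ℕ) : DiscreteTopology (DMSym M N) := ⟨rfl⟩
instance (M N : ℕ) : MeasurableSpace (DMSym M N) := ⊤
instance (M N : ℕ) : BorelSpace (DMSym M N) := ⟨borel_eq_top_of_discrete.symm⟩

end DMSym

/-- Nonzero elements of the Dyck–Motzkin monoid with zero are represented in normal form: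
`some (bs, as)` is the reduced word `β_{bs(0)} ⋯ β_{bs(r)} α_{as(0)} ⋯ α_{as(s)}`
(in particular `some ([], [])` is the unit element `1`); `none` is the zero element `0`. -/
abbrev DyckElem (M : ℕ) := Option (List (Fin M) × List (Fin M))

/-- Multiplication, in the Dyck–Motzkin monoid with zero, of an element in normal form on
the right by a generator: units are absorbed, a left bracket is appended, and a right bracket
either closes the last left bracket (if the indices match), is appended (if there is no left
bracket to close), or produces the zero element (if the indices do not match). -/
def dyckStep {M N : ℕ} : DyckElem M → DMSym M N → DyckElem M
  | none, _ => none
  | some (bs, as), .la k => some (bs, as ++ [k])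
  | some (bs, as), .u _ => some (bs, as)
  | some (bs, as), .ra k =>
      match as.getLast? with
      | none => some (bs ++ [k], [])
      | some j => if j = k then some (bs, as.dropLast) else none

/-- `red w` is the image of the word `w` in the Dyck–Motzkin monoid with zero. -/
def red {M N : ℕ} (w : List (DMSym M N)) : DyckElem M :=
  w.foldl dyckStep (some ([], []))

/-- The word `x_j x_{j+1} ⋯ x_k` read off a bi-infinite sequence `x`. -/
def wordAt {M N : ℕ} (x : ℤ → DMSym M N) (j k : ℤ) : List (DMSym M N) :=
  (List.range (k + 1 - j).toNat).map fun n => x (j + n)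

/-- The `(M,N)` Dyck–Motzkin shift `Σ_D`. -/
def SigmaD (M N : ℕ) : Set (ℤ → DMSym M N) :=
  {x | ∀ j k : ℤ, j < k → red (wordAt x j k) ≠ none}

/-- The left shift `σ`. -/
def shift {A : Type*} : (ℤ → A) → (ℤ → A) := fun x i => x (i + 1)

/-- The inverse `σ⁻¹` of the left shift. -/
def shiftInv {A : Type*} : (ℤ → A) → (ℤ → A) := fun x i => x (i - 1)

lemma wordAt_shift {M N : ℕ} (x : ℤ → DMSym M N) (j k : ℤ) :
    wordAt (shift x) j k = wordAt x (j + 1) (k + 1) := by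
  simp only [wordAt, shift]
  rw [show (k + 1 + 1 - (j + 1) : ℤ) = k + 1 - j by ring]
  exact List.map_congr_left fun n _ => by rw [show (j + n + 1 : ℤ) = j + 1 + n by ring]

lemma shift_mem_SigmaD {M N : ℕ} {x : ℤ → DMSym M N} (hx : x ∈ SigmaD M N) :
    shift x ∈ SigmaD M N := by
  intro j k hjk
  rw [wordAt_shift]
  exact hx (j + 1) (k + 1) (by omega)

/-- The left shift acting on `Σ_D`. -/
def shiftD (M N : ℕ) : ↥(SigmaD M N) → ↥(SigmaD M N) :=
  fun x => ⟨shift x.val, shift_mem_SigmaD x.property⟩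

section Generic
variable {X : Type*} [MeasurableSpace X]

/-- The set of `T`-invariant Borel probability measures. -/
def InvMeas (T : X → X) : Set (ProbabilityMeasure X) :=
  {μ | MeasurePreserving T μ.toMeasure μ.toMeasure}

/-- The set of `T`-invariant ergodic Borel probability measures. -/
def ErgMeas (T : X → X) : Set (ProbabilityMeasure X) :=
  {μ | Ergodic T μ.toMeasure}

/-- A `CO`-measure: an invariant ergodic probability measure supported on the orbit of a
single periodic point. -/
def IsCOMeas (T : X → X) (μ : ProbabilityMeasure X) : Prop :=
  Ergodic T μ.toMeasure ∧
    ∃ (x : X) (n : ℕ), 0 < n ∧ T^[n] x = x ∧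
      μ.toMeasure {y | ∃ k : ℕ, y = T^[k] x} = 1

/-- Convexity for a set of probability measures: it is stable under taking the convex
combination `t•μ + (1-t)•ν` of any two of its members. -/
def ConvexMeasSet (U : Set (ProbabilityMeasure X)) : Prop :=
  ∀ μ ∈ U, ∀ ν ∈ U, ∀ t : ℝ≥0∞, t ≤ 1 → ∀ ρ : ProbabilityMeasure X,
    ρ.toMeasure = t • μ.toMeasure + (1 - t) • ν.toMeasure → ρ ∈ U

/-- A measure is fully supported if it gives positive measure to every non-empty open set. -/
def FullSupp [TopologicalSpace X] (μ : ProbabilityMeasure X) : Prop :=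
  ∀ U : Set X, IsOpen U → U.Nonempty → 0 < μ.toMeasure U

/-- Measure-theoretic isomorphism of the measure-preserving systems `(X,T,μ)` and `(Y,S,ν)`. -/
def MeasureIso {Y : Type*} [MeasurableSpace Y] (T : X → X) (S : Y → Y)
    (μ : Measure X) (ν : Measure Y) : Prop :=
  ∃ (φ : X → Y) (ψ : Y → X), Measurable φ ∧ Measurable ψ ∧
    Measure.map φ μ = ν ∧ Measure.map ψ ν = μ ∧
    (∀ᵐ x ∂μ, ψ (φ x) = x) ∧ (∀ᵐ y ∂ν, φ (ψ y) = y) ∧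
    (∀ᵐ x ∂μ, φ (T x) = S (φ x))

/-- The system `(X,T,μ)` is Bernoulli: it is measure-theoretically isomorphic to a two-sided
Bernoulli shift, i.e. the left shift on `ℤ → ℕ` equipped with an i.i.d. product measure
(determined by requiring that the measures of all cylinder sets factorize according to a
fixed distribution `p`). -/
def IsBernoulli (T : X → X) (μ : Measure X) : Prop :=
  ∃ (p : ℕ → ℝ≥0∞) (ν : Measure (ℤ → ℕ)), (∑' n, p n) = 1 ∧
    IsProbabilityMeasure ν ∧
    (∀ (n : ℕ) (w : Fin n → ℕ) (j : ℤ),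
      ν {y | ∀ i : Fin n, y (j + (i : ℕ)) = w i} = ∏ i, p (w i)) ∧
    MeasureIso T shift μ ν

end Generic

/-- `M(Σ_D)`: the space of shift-invariant Borel probability measures on `Σ_D`,
endowed with the weak* topology. -/
def MinvD (M N : ℕ) : Set (ProbabilityMeasure ↥(SigmaD M N)) := InvMeas (shiftD M N)

/-- `M^e(Σ_D)`: the shift-invariant ergodic Borel probability measures on `Σ_D`. -/
def MergD (M N : ℕ) : Set (ProbabilityMeasure ↥(SigmaD M N)) := ErgMeas (shiftD M N)

/-- The integral `∫ f dμ`. -/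
noncomputable def intCf {M N : ℕ} (f : C(↥(SigmaD M N), ℝ))
    (μ : ProbabilityMeasure ↥(SigmaD M N)) : ℝ := ∫ x, f x ∂μ.toMeasure

/-- `M_max(f)`: the set of `f`-maximizing measures, i.e. the shift-invariant measures
attaining `sup { ∫ f dν : ν ∈ M(Σ_D) }`. -/
def Mmax (M N : ℕ) (f : C(↥(SigmaD M N), ℝ)) : Set (ProbabilityMeasure ↥(SigmaD M N)) :=
  {μ ∈ MinvD M N | ∀ ν ∈ MinvD M N, intCf f ν ≤ intCf f μ}

/-- `G_j(x)`: `1` on left brackets, `-1` on right brackets, `0` on units. -/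
def Gfun {M N : ℕ} (x : ℤ → DMSym M N) (j : ℤ) : ℤ :=
  match x j with
  | .la _ => 1
  | .u _ => 0
  | .ra _ => -1

/-- `H_i(x) = Σ_{j=0}^{i-1} G_j(x)` for `i ≥ 1`, `H_i(x) = -Σ_{j=i}^{-1} G_j(x)` for
`i ≤ -1`, and `H_0(x) = 0`. -/
def Hfun {M N : ℕ} (x : ℤ → DMSym M N) (i : ℤ) : ℤ :=
  if 0 ≤ i then ∑ j ∈ Finset.range i.toNat, Gfun x (j : ℤ)
  else -∑ j ∈ Finset.range (-i).toNat, Gfun x (i + (j : ℤ))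

/-- The set `A_0`. -/
def A0set (M N : ℕ) : Set (ℤ → DMSym M N) :=
  SigmaD M N ∩ {x | ∀ i : ℤ,
    (∃ j : ℕ, 1 ≤ j ∧ Hfun x (i + (j : ℤ)) = Hfun x i) ∧
    (∃ j : ℕ, 1 ≤ j ∧ Hfun x (i - (j : ℤ)) = Hfun x i)}

/-- The set `A_α`. -/
def AalphaSet (M N : ℕ) : Set (ℤ → DMSym M N) :=
  SigmaD M N ∩ {x | Tendsto (Hfun x) atTop atTop ∧ Tendsto (Hfun x) atBot atBot}

/-- The set `A_β`. -/
def AbetaSet (M N : ℕ) : Set (ℤ → DMSym M N) :=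
  SigmaD M N ∩ {x | Tendsto (Hfun x) atTop atBot ∧ Tendsto (Hfun x) atBot atTop}

/-- The set `B_α` of sequences in `Σ_D` in which every right bracket is closed. -/
def BalphaSet (M N : ℕ) : Set (ℤ → DMSym M N) :=
  SigmaD M N ∩ {x | ∀ i : ℤ, (∃ k, x i = DMSym.ra k) →
    ∃ j : ℕ, 1 ≤ j ∧ Hfun x (i - (j : ℤ) + 1) = Hfun x (i + 1)}

/-- The set `B_β` of sequences in `Σ_D` in which every left bracket is closed. -/
def BbetaSet (M N : ℕ) : Set (ℤ → DMSym M N) :=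
  SigmaD M N ∩ {x | ∀ i : ℤ, (∃ k, x i = DMSym.la k) →
    ∃ j : ℕ, 1 ≤ j ∧ Hfun x (i + (j : ℤ)) = Hfun x i}

/-- The alphabet `D_α ∪ D_0 ∪ {β}` of the full shift `Σ_α`. -/
inductive AlSym (M N : ℕ) : Type where
  | la : Fin M → AlSym M N
  | u  : Fin N → AlSym M N
  | b  : AlSym M N
deriving DecidableEq

namespace AlSym

def equivSum (M N : ℕ) : AlSym M N ≃ (Fin M ⊕ Fin N ⊕ Unit) where
  toFun s := match s with
    | .la k => Sum.inl k
    | .u k => Sum.inr (Sum.inl k)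
    | .b => Sum.inr (Sum.inr ())
  invFun s := match s with
    | Sum.inl k => .la k
    | Sum.inr (Sum.inl k) => .u k
    | Sum.inr (Sum.inr _) => .b
  left_inv s := by cases s <;> rfl
  right_inv s := by rcases s with k | k | k <;> rfl

instance (M N : ℕ) : Fintype (AlSym M N) := Fintype.ofEquiv _ (equivSum M N).symm
instance (M N : ℕ) : TopologicalSpace (AlSym M N) := ⊥
instance (M N : ℕ) : DiscreteTopology (AlSym M N) := ⟨rfl⟩
instance (M N : ℕ) : MeasurableSpace (AlSym M N) := ⊤
instance (M N : ℕ) : BorelSpace (AlSym M N) := ⟨borel_eq_top_of_discrete.symm⟩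

end AlSym

/-- The factor map `φ_α : Σ_D → Σ_α` replacing every right bracket by the single symbol `β`. -/
def phiAl {M N : ℕ} (x : ℤ → DMSym M N) : ℤ → AlSym M N := fun i =>
  match x i with
  | .la k => .la k
  | .u k => .u k
  | .ra _ => .b

/-- `K_α = φ_α(B_α)`. -/
def Kalpha (M N : ℕ) : Set (ℤ → AlSym M N) := phiAl '' BalphaSet M N

/-- `G_{α,j}`. -/
def GAl {M N : ℕ} (y : ℤ → AlSym M N) (j : ℤ) : ℤ :=
  match y j with
  | .la _ => 1
  | .u _ => 0
  | .b => -1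

/-- `H_{α,i}`. -/
def HAl {M N : ℕ} (y : ℤ → AlSym M N) (i : ℤ) : ℤ :=
  if 0 ≤ i then ∑ j ∈ Finset.range i.toNat, GAl y (j : ℤ)
  else -∑ j ∈ Finset.range (-i).toNat, GAl y (i + (j : ℤ))

/-- `s_α(i,y) = max { j < i+1 : H_{α,j}(y) = H_{α,i+1}(y) }`. -/
noncomputable def sAl {M N : ℕ} (y : ℤ → AlSym M N) (i : ℤ) : ℤ :=
  sSup {j : ℤ | j < i + 1 ∧ HAl y j = HAl y (i + 1)}

/-- `ψ_α : K_α → Σ_D`, replacing each `β` by the right bracket matching the left bracket at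
position `s_α(i,y)` (defined as a total function using a junk value outside `K_α`). -/
noncomputable def psiAl (M N : ℕ) (hM : 0 < M) (y : ℤ → AlSym M N) : ℤ → DMSym M N := fun i =>
  match y i with
  | .la k => .la k
  | .u k => .u k
  | .b =>
    match y (sAl y i) with
    | .la k => .ra k
    | _ => .ra ⟨0, hM⟩

/-- The function `E_α = 2·𝟙_{Σ_α(α)} + 𝟙_{Σ_α(0)}`. -/
def EAl {M N : ℕ} (y : ℤ → AlSym M N) : ℝ :=
  match y 0 with
  | .la _ => 2
  | .u _ => 1
  | .b => 0

/-- `M^{CO}(Σ_D)`: the set of `CO`-measures on `Σ_D`. -/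
def MCO (M N : ℕ) : Set (ProbabilityMeasure ↥(SigmaD M N)) :=
  {μ | IsCOMeas (shiftD M N) μ}

/-- `M^e_0(Σ_D) = { μ ∈ M^e(Σ_D) : μ(A_0) = 1 }`. -/
def Me0 (M N : ℕ) : Set (ProbabilityMeasure ↥(SigmaD M N)) :=
  {μ ∈ MergD M N | μ.toMeasure (Subtype.val ⁻¹' A0set M N) = 1}

/-- `M^e_α(Σ_D) = { μ ∈ M^e(Σ_D) : μ(A_α) = 1 }`. -/
def MeAl (M N : ℕ) : Set (ProbabilityMeasure ↥(SigmaD M N)) :=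
  {μ ∈ MergD M N | μ.toMeasure (Subtype.val ⁻¹' AalphaSet M N) = 1}

/-- `M^e_β(Σ_D) = { μ ∈ M^e(Σ_D) : μ(A_β) = 1 }`. -/
def MeBe (M N : ℕ) : Set (ProbabilityMeasure ↥(SigmaD M N)) :=
  {μ ∈ MergD M N | μ.toMeasure (Subtype.val ⁻¹' AbetaSet M N) = 1}

lemma continuous_phiAl {M N : ℕ} :
    Continuous (phiAl : (ℤ → DMSym M N) → (ℤ → AlSym M N)) := by
  refine continuous_pi fun i => ?_
  have h : (fun x : ℤ → DMSym M N => phiAl x i)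
      = (fun s : DMSym M N => phiAl (fun _ => s) i) ∘ (fun x => x i) := rfl
  rw [h]
  exact continuous_of_discreteTopology.comp (continuous_apply i)

lemma measurable_phiAl_val {M N : ℕ} :
    Measurable (fun x : ↥(SigmaD M N) => phiAl x.val) :=
  (continuous_phiAl.comp continuous_subtype_val).measurable

/-! ### Auxiliary lemmas for the proof -/

lemma Hfun_succ_aux {M N : ℕ} (x : ℤ → DMSym M N) (i : ℤ) :
    Hfun x (i + 1) = Hfun x i + Gfun x i := by
  rcases le_or_gt 0 i with hi | hi
  · obtain ⟨n, rfl⟩ := Int.eq_ofNat_of_zero_le hi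
    have h1 : ((n : ℤ) + 1).toNat = n + 1 := by omega
    have h2 : (0 : ℤ) ≤ (n : ℤ) + 1 := by omega
    simp only [Hfun, if_pos hi, if_pos h2, h1, Int.toNat_natCast, Finset.sum_range_succ]
  · obtain ⟨n, hn⟩ : ∃ n : ℕ, i = -(n : ℤ) - 1 := ⟨(-i - 1).toNat, by omega⟩
    subst hn
    have h1 : (-(-(n : ℤ) - 1)).toNat = n + 1 := by omega
    have h3 : ¬ (0 : ℤ) ≤ -(n : ℤ) - 1 := by omega
    have key : Hfun x (-(n : ℤ) - 1 + 1)
        = -∑ j ∈ Finset.range n, Gfun x (-(n : ℤ) - 1 + ((j + 1 : ℕ) : ℤ)) := by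
      unfold Hfun
      split_ifs with h
      · have : n = 0 := by omega
        subst this
        simp
      · have h4 : (-(-(n : ℤ) - 1 + 1)).toNat = n := by omega
        rw [h4]
        congr 1
        refine Finset.sum_congr rfl fun j _ => ?_
        congr 1
        push_cast
        ring
    rw [key]
    simp only [Hfun, if_neg h3, h1]
    rw [Finset.sum_range_succ']
    simp

lemma wordAt_succ_aux {M N : ℕ} (x : ℤ → DMSym M N) (j : ℤ) (n : ℕ) :
    wordAt x j (j + (n + 1 : ℕ)) = wordAt x j (j + n) ++ [x (j + (n + 1 : ℕ))] := by
  have h1 : (j + ((n + 1 : ℕ) : ℤ) + 1 - j).toNat = (n + 1) + 1 := by omega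
  have h2 : (j + (n : ℤ) + 1 - j).toNat = n + 1 := by omega
  simp only [wordAt, h1, h2]
  rw [List.range_succ (n := n + 1)]
  simp

lemma red_wordAt_succ_aux {M N : ℕ} (x : ℤ → DMSym M N) (j : ℤ) (n : ℕ) :
    red (wordAt x j (j + (n + 1 : ℕ))) =
      dyckStep (red (wordAt x j (j + n))) (x (j + (n + 1 : ℕ))) := by
  rw [wordAt_succ_aux]
  simp [red, List.foldl_append]

/-- In an admissible sequence, after a left bracket at `j` that is not yet closed, the reduced
word starts with that left bracket. -/
lemma red_prefix_aux {M N : ℕ} (z : ℤ → DMSym M N) (hz : z ∈ SigmaD M N) (H : ℤ → ℤ)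
    (j : ℤ) (a : Fin M) (hj : z j = .la a) (m : ℕ)
    (hH : ∀ l : ℤ, j ≤ l → l ≤ j + m → H (l + 1) = H l + Gfun z l)
    (hpos : ∀ l : ℤ, j < l → l ≤ j + m + 1 → H j < H l) (n : ℕ) (hn : n ≤ m) :
    ∃ t : List (Fin M), red (wordAt z j (j + n)) = some ([], a :: t) ∧
      ((a :: t).length : ℤ) = H (j + n + 1) - H j := by
  induction n with
  | zero =>
    refine ⟨[], ?_, ?_⟩
    · have h1 : (j + ((0 : ℕ) : ℤ) + 1 - j).toNat = 1 := by omega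
      simp only [wordAt, h1]
      simp [red, hj, dyckStep]
    · have := hH j le_rfl (by omega)
      simp only [Gfun, hj] at this
      simp [this]
  | succ n ih =>
    obtain ⟨t, ht, hlen⟩ := ih (by omega)
    have hne := hz j (j + (n + 1 : ℕ)) (by omega)
    have hstep := red_wordAt_succ_aux z j n
    have hHs := hH (j + (n + 1 : ℕ)) (by omega) (by omega)
    have hp := hpos (j + (n + 1 : ℕ) + 1) (by omega) (by omega)
    have he : (j + ((n + 1 : ℕ) : ℤ)) = j + n + 1 := by push_cast; ring
    rw [ht] at hstep
    rw [hstep] at hne ⊢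
    rw [← he] at hlen
    simp only [Gfun] at hHs
    cases hzz : z (j + (n + 1 : ℕ)) with
    | la k =>
      rw [hzz] at hHs
      refine ⟨t ++ [k], by simp [dyckStep], ?_⟩
      simp only [List.length_cons, List.length_append, List.length_nil] at hlen ⊢
      push_cast at hlen ⊢
      push_cast at hHs
      linarith
    | u k =>
      rw [hzz] at hHs
      refine ⟨t, by simp [dyckStep], ?_⟩
      simp only at hHs
      rw [hlen, hHs]; ring
    | ra k =>
      rw [hzz] at hHs hne
      simp only at hHs
      rcases List.eq_nil_or_concat t with rfl | ⟨s, b, rfl⟩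
      · simp only [List.length_cons, List.length_nil] at hlen
        push_cast at hlen hHs hp
        linarith
      · simp only [List.concat_eq_append] at hlen hne ⊢
        have hgl : (a :: (s ++ [b])).getLast? = some b := by
          rw [← List.cons_append]; exact List.getLast?_concat
        have hdl : (a :: (s ++ [b])).dropLast = a :: s := by
          rw [← List.cons_append]; exact List.dropLast_concat
        simp only [dyckStep, hgl, hdl] at hne ⊢
        by_cases hbk : b = k
        · refine ⟨s, by simp [hbk], ?_⟩
          simp only [List.length_cons, List.length_append, List.length_nil] at hlen ⊢
          push_cast at hlen ⊢
          push_cast at hHs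
          linarith
        · simp [hbk] at hne

/-- Matching brackets in an admissible sequence carry the same index. -/
lemma match_index_aux {M N : ℕ} (z : ℤ → DMSym M N) (hz : z ∈ SigmaD M N) (H : ℤ → ℤ)
    (j i : ℤ) (hji : j < i) (a b : Fin M) (hj : z j = .la a) (hi : z i = .ra b)
    (hH : ∀ l : ℤ, j ≤ l → l ≤ i → H (l + 1) = H l + Gfun z l)
    (hpos : ∀ l : ℤ, j < l → l ≤ i → H j < H l) (hend : H (i + 1) = H j) : a = b := by
  obtain ⟨m, rfl⟩ : ∃ m : ℕ, i = j + (m + 1 : ℕ) := ⟨(i - j - 1).toNat, by omega⟩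
  obtain ⟨t, ht, hlen⟩ := red_prefix_aux z hz H j a hj m
    (fun l h1 h2 => hH l h1 (by omega)) (fun l h1 h2 => hpos l h1 (by omega)) m le_rfl
  have hne := hz j (j + (m + 1 : ℕ)) hji
  have he : (j + ((m + 1 : ℕ) : ℤ)) = j + m + 1 := by push_cast; ring
  have h1 := hH (j + (m + 1 : ℕ)) (by omega) le_rfl
  simp only [Gfun, hi] at h1
  rw [red_wordAt_succ_aux, ht, hi] at hne
  rw [← he] at hlen
  have ht0 : t = [] := by
    apply List.length_eq_zero_iff.mp
    simp only [List.length_cons] at hlen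
    push_cast at hlen h1 hend
    omega
  subst ht0
  by_contra hab
  simp [dyckStep, hab] at hne

lemma Gfun_congr_aux {M N : ℕ} {x z : ℤ → DMSym M N} {l : ℤ} (h : phiAl z l = phiAl x l) :
    Gfun z l = Gfun x l := by
  unfold phiAl at h
  unfold Gfun
  cases hz : z l <;> cases hx : x l <;> simp_all

lemma eq_la_of_phi_aux {M N : ℕ} {x z : ℤ → DMSym M N} {l : ℤ} {a : Fin M}
    (h : phiAl z l = phiAl x l) (hx : x l = .la a) : z l = .la a := by
  unfold phiAl at h
  cases hz : z l <;> simp_all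

lemma eq_u_of_phi_aux {M N : ℕ} {x z : ℤ → DMSym M N} {l : ℤ} {a : Fin N}
    (h : phiAl z l = phiAl x l) (hx : x l = .u a) : z l = .u a := by
  unfold phiAl at h
  cases hz : z l <;> simp_all

lemma eq_ra_of_phi_aux {M N : ℕ} {x z : ℤ → DMSym M N} {l : ℤ} {a : Fin M}
    (h : phiAl z l = phiAl x l) (hx : x l = .ra a) : ∃ b, z l = .ra b := by
  unfold phiAl at h
  cases hz : z l <;> simp_all

/-- If every right bracket of `x` is closed, then each symbol of `x` is determined by finitely
many symbols of its image. -/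
lemma finite_window_aux {M N : ℕ} (x : ℤ → DMSym M N) (hx : x ∈ SigmaD M N)
    (hB : ∀ i : ℤ, ∃ j : ℤ, j ≤ i ∧ Hfun x j ≤ Hfun x (i + 1) ∨ ∀ k, x i ≠ .ra k)
    (i : ℤ) : ∃ s : Finset ℤ, ∀ z ∈ SigmaD M N, (∀ l ∈ s, phiAl z l = phiAl x l) → z i = x i := by
  cases hxi : x i with
  | la a => exact ⟨{i}, fun z _ h => eq_la_of_phi_aux (h i (by simp)) hxi⟩
  | u a => exact ⟨{i}, fun z _ h => eq_u_of_phi_aux (h i (by simp)) hxi⟩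
  | ra k =>
    obtain ⟨j₀, hj₀ | hj₀⟩ := hB i
    swap
    · exact absurd hxi (hj₀ k)
    obtain ⟨j, ⟨hj1, hj2⟩, hjmax⟩ := Int.exists_greatest_of_bdd
      (P := fun j => j ≤ i ∧ Hfun x j ≤ Hfun x (i + 1)) ⟨i, fun z hz => hz.1⟩ ⟨j₀, hj₀⟩
    have hHi := Hfun_succ_aux x i
    simp only [Gfun, hxi] at hHi
    have hji : j < i := by
      rcases lt_or_eq_of_le hj1 with h | rfl
      · exact h
      · omega
    have hbig : ∀ l, j < l → l ≤ i → Hfun x (i + 1) < Hfun x l := by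
      intro l h1 h2
      by_contra hcon
      have := hjmax l ⟨h2, not_lt.mp hcon⟩
      omega
    have hHj := Hfun_succ_aux x j
    have hb1 := hbig (j + 1) (by omega) (by omega)
    obtain ⟨a, ha⟩ : ∃ a, x j = .la a := by
      cases hxj : x j with
      | la a => exact ⟨a, rfl⟩
      | u a => simp only [Gfun, hxj] at hHj; omega
      | ra a => simp only [Gfun, hxj] at hHj; omega
    simp only [Gfun, ha] at hHj
    have heq : Hfun x (i + 1) = Hfun x j := by omega
    have key : ∀ z ∈ SigmaD M N, (∀ l ∈ Finset.Icc j i, phiAl z l = phiAl x l) →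
        z i = .ra a := by
      intro z hz h
      obtain ⟨b, hb⟩ := eq_ra_of_phi_aux (h i (by simp; omega)) hxi
      have hab := match_index_aux z hz (Hfun x) j i hji a b
        (eq_la_of_phi_aux (h j (by simp; omega)) ha) hb
        (fun l h1 h2 => by
          rw [Hfun_succ_aux, Gfun_congr_aux (h l (by simp; omega))])
        (fun l h1 h2 => heq ▸ hbig l h1 h2) heq
      rw [hb, hab]
    refine ⟨Finset.Icc j i, fun z hz h => ?_⟩
    rw [key z hz h, ← key x hx (fun _ _ => rfl), hxi]

/-- At points all of whose right brackets are closed, the topology of `Σ_D` is induced by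
the factor map. -/
lemma exists_open_aux {M N : ℕ} (x : ↥(SigmaD M N))
    (hB : ∀ i : ℤ, ∃ j : ℤ, j ≤ i ∧ Hfun x.val j ≤ Hfun x.val (i + 1) ∨ ∀ k, x.val i ≠ .ra k)
    (G : Set ↥(SigmaD M N)) (hG : IsOpen G) (hxG : x ∈ G) :
    ∃ V : Set (ℤ → AlSym M N), IsOpen V ∧ phiAl x.val ∈ V ∧
      (fun z : ↥(SigmaD M N) => phiAl z.val) ⁻¹' V ⊆ G := by
  obtain ⟨O, hO, rfl⟩ := isOpen_induced_iff.mp hG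
  obtain ⟨I, u, hu, hsub⟩ := isOpen_pi_iff.mp hO x.val hxG
  choose s hs using finite_window_aux x.val x.property hB
  refine ⟨⋂ l ∈ I.biUnion s, {y | y l = phiAl x.val l}, ?_, ?_, ?_⟩
  · refine isOpen_biInter_finset fun l _ => ?_
    have hc : Continuous (fun y : ℤ → AlSym M N => y l) := continuous_apply l
    exact (isOpen_discrete {phiAl x.val l}).preimage hc
  · simp
  · intro z hz
    apply hsub
    intro i hi
    have : z.val i = x.val i := by
      refine hs i z.val z.property fun l hl => ?_
      simp only [Set.mem_preimage, Set.mem_iInter] at hz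
      exact hz l (Finset.mem_biUnion.mpr ⟨i, hi, hl⟩)
    rw [this]
    exact (hu i hi).2

lemma closed_of_A0_aux {M N : ℕ} (x : ℤ → DMSym M N) (hx : x ∈ A0set M N) (i : ℤ) :
    ∃ j : ℤ, j ≤ i ∧ Hfun x j ≤ Hfun x (i + 1) ∨ ∀ k, x i ≠ .ra k := by
  obtain ⟨j, hj, h⟩ := (hx.2 (i + 1)).2
  exact ⟨i + 1 - j, Or.inl ⟨by omega, h.le⟩⟩

lemma closed_of_Aalpha_aux {M N : ℕ} (x : ℤ → DMSym M N) (hx : x ∈ AalphaSet M N) (i : ℤ) :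
    ∃ j : ℤ, j ≤ i ∧ Hfun x j ≤ Hfun x (i + 1) ∨ ∀ k, x i ≠ .ra k := by
  have h1 := hx.2.2.eventually (eventually_le_atBot (Hfun x (i + 1)))
  obtain ⟨j, hj1, hj2⟩ := (h1.and (eventually_le_atBot i)).exists
  exact ⟨j, Or.inl ⟨hj2, hj1⟩⟩

/-- Lemma 3.7: let `μ ∈ M^e_0(Σ_D) ∪ M^e_α(Σ_D)` and let `(ρ_n)` be ergodic measures with
`ρ_n(B_α) = 1` and `∫ E_α∘φ_α dρ_n > 1`. If the push-forwards `ρ_n ∘ φ_α⁻¹` converge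
weakly* to `μ ∘ φ_α⁻¹`, then `ρ_n` converges weakly* to `μ`. -/
theorem pushforward_convergence_implies_convergence (M N : ℕ) (hM : 2 ≤ M)
    (μ : ProbabilityMeasure ↥(SigmaD M N)) (hμ : μ ∈ Me0 M N ∪ MeAl M N)
    (ρ : ℕ → ProbabilityMeasure ↥(SigmaD M N))
    (hρe : ∀ n, ρ n ∈ MergD M N)
    (hρB : ∀ n, (ρ n).toMeasure (Subtype.val ⁻¹' BalphaSet M N) = 1)
    (hρE : ∀ n, 1 < ∫ x, EAl (phiAl x.val) ∂(ρ n).toMeasure)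
    (hconv : Tendsto
      (fun n => (ρ n).map (f := fun x => phiAl x.val) measurable_phiAl_val.aemeasurable)
      atTop (𝓝 (μ.map (f := fun x => phiAl x.val) measurable_phiAl_val.aemeasurable))) :
    Tendsto ρ atTop (𝓝 μ) := by
  obtain ⟨B, hB1, hB⟩ : ∃ B : Set ↥(SigmaD M N), μ.toMeasure B = 1 ∧ ∀ x ∈ B, ∀ i : ℤ,
      ∃ j : ℤ, j ≤ i ∧ Hfun x.val j ≤ Hfun x.val (i + 1) ∨ ∀ k, x.val i ≠ .ra k := by
    rcases hμ with h | h
    · exact ⟨_, h.2, fun x hx => closed_of_A0_aux x.val hx⟩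
    · exact ⟨_, h.2, fun x hx => closed_of_Aalpha_aux x.val hx⟩
  refine tendsto_of_forall_isOpen_le_liminf' fun G hG => ?_
  let φ : ↥(SigmaD M N) → (ℤ → AlSym M N) := fun x => phiAl x.val
  have hφ : Measurable φ := measurable_phiAl_val
  let W : Set (ℤ → AlSym M N) := ⋃₀ {V | IsOpen V ∧ φ ⁻¹' V ⊆ G}
  have hW : IsOpen W := isOpen_sUnion fun V hV => hV.1
  have hWG : φ ⁻¹' W ⊆ G := by
    rintro x ⟨V, hV, hxV⟩
    exact hV.2 hxV
  have hWm : MeasurableSet (φ ⁻¹' W) := hφ hW.measurableSet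
  have hE : MeasurableSet (Gᶜ ∪ φ ⁻¹' W) := hG.measurableSet.compl.union hWm
  have hBE : B ⊆ Gᶜ ∪ φ ⁻¹' W := by
    intro x hx
    by_cases hxG : x ∈ G
    · obtain ⟨V, hV, hxV, hVG⟩ := exists_open_aux x (hB x hx) G hG hxG
      exact Or.inr ⟨V, ⟨hV, hVG⟩, hxV⟩
    · exact Or.inl hxG
  have hE1 : μ.toMeasure (Gᶜ ∪ φ ⁻¹' W) = 1 :=
    le_antisymm prob_le_one (hB1 ▸ measure_mono hBE)
  have hE0 : μ.toMeasure (Gᶜ ∪ φ ⁻¹' W)ᶜ = 0 := (prob_compl_eq_zero_iff hE).mpr hE1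
  have hle : μ.toMeasure G ≤ μ.toMeasure (φ ⁻¹' W) := by
    calc μ.toMeasure G ≤ μ.toMeasure (φ ⁻¹' W ∪ (Gᶜ ∪ φ ⁻¹' W)ᶜ) := by
          refine measure_mono fun x hx => ?_
          by_cases h : x ∈ φ ⁻¹' W
          · exact Or.inl h
          · refine Or.inr ?_
            rintro (h' | h')
            · exact h' hx
            · exact h h'
      _ ≤ μ.toMeasure (φ ⁻¹' W) + μ.toMeasure (Gᶜ ∪ φ ⁻¹' W)ᶜ := measure_union_le _ _
      _ = μ.toMeasure (φ ⁻¹' W) := by rw [hE0, add_zero]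
  have hlim := ProbabilityMeasure.le_liminf_measure_open_of_tendsto hconv hW
  have hmap : ∀ ν : ProbabilityMeasure ↥(SigmaD M N),
      ((ν.map (f := fun x => phiAl x.val) measurable_phiAl_val.aemeasurable :
        ProbabilityMeasure (ℤ → AlSym M N)) : Measure (ℤ → AlSym M N)) W
        = ν.toMeasure (φ ⁻¹' W) := by
    intro ν
    rw [ProbabilityMeasure.toMeasure_map]
    exact Measure.map_apply hφ hW.measurableSet
  simp only [hmap] at hlim
  refine hle.trans (hlim.trans ?_)
  exact liminf_le_liminf (.of_forall fun n => measure_mono hWG)
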